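/- Fix k ≥ 1 and consider the reinforced urn model RUM(k,f) with f(j) = j². Then the probability under P^{(k)} that only a finite number of white balls are ever picked is at most (1/2) exp(−(k−1) + π/(2√(k+2))). -/

import Mathlib

open MeasureTheory ProbabilityTheory Filter

noncomputable section

/-- A reinforced urn model `RUM(k, f)`: the urn starts with `k` white balls and `1` red
ball; `X n` records whether the `n`-th extraction (`n ≥ 1`) is white.  If exactly `j` white
balls have been picked among the first `n` extractions, the probability that the `(n+1)`-th
pick is white, conditionally on the first `n` picks, is `f(k+j)/(f(k+j) + f(n+1-j))`. -/
structure RUM {Ω : Type} [m0 : MeasurableSpace Ω] (μ : Measure Ω) (k : ℕ) (f : ℕ → ℝ) where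
  X : ℕ → Ω → Bool
  meas_X : ∀ n, Measurable (X n)
  f_pos : ∀ i, 1 ≤ i → 0 < f i
  cond_white : ∀ n : ℕ,
    (μ[Set.indicator {ω | X (n + 1) ω = true} (fun _ => (1 : ℝ)) |
        MeasurableSpace.comap (fun ω => fun i : Fin n => X (i + 1) ω) inferInstance])
      =ᵐ[μ] fun ω =>
        f (k + ((Finset.Icc 1 n).filter fun i => X i ω = true).card) /
          (f (k + ((Finset.Icc 1 n).filter fun i => X i ω = true).card) +
            f (n + 1 - ((Finset.Icc 1 n).filter fun i => X i ω = true).card))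

/-- The number of white balls among the first `n` extractions. -/
def RUM.whiteCount {Ω : Type} [MeasurableSpace Ω] {μ : Measure Ω} {k : ℕ} {f : ℕ → ℝ}
    (U : RUM μ k f) (n : ℕ) (ω : Ω) : ℕ :=
  ((Finset.Icc 1 n).filter fun i => U.X i ω = true).card

lemma measurable_card_filter_true {Ω : Type} [MeasurableSpace Ω] {X : ℕ → Ω → Bool}
    (s : Finset ℕ) (h : ∀ i ∈ s, Measurable (X i)) :
    Measurable fun ω => (s.filter fun i => X i ω = true).card := by
  simp only [Finset.card_filter]
  refine Finset.measurable_fun_sum _ fun i hi => ?_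
  exact (Measurable.of_discrete (f := fun b : Bool => if b = true then (1 : ℕ) else 0)).comp (h i hi)

namespace RUM

variable {Ω : Type} [m0 : MeasurableSpace Ω] {μ : Measure Ω} {k : ℕ} {f : ℕ → ℝ}

lemma whiteCount_zero (U : RUM μ k f) (ω : Ω) : U.whiteCount 0 ω = 0 := by
  simp [whiteCount]

lemma whiteCount_le (U : RUM μ k f) (n : ℕ) (ω : Ω) : U.whiteCount n ω ≤ n := by
  simpa [whiteCount] using
    Finset.card_filter_le (Finset.Icc 1 n) (fun i => U.X i ω = true)

lemma whiteCount_succ (U : RUM μ k f) (n : ℕ) (ω : Ω) :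
    U.whiteCount (n + 1) ω = U.whiteCount n ω + if U.X (n + 1) ω = true then 1 else 0 := by
  simp only [whiteCount, Finset.card_filter]
  rw [Finset.sum_Icc_succ_top (by omega)]

lemma finite_whites_subset (U : RUM μ k f) (N : ℕ) :
    {ω | {n | 1 ≤ n ∧ U.X n ω = true}.Finite} ⊆ ⋃ n, {ω | N ≤ n - U.whiteCount n ω} := by
  intro ω hω
  have hfin : {n | 1 ≤ n ∧ U.X n ω = true}.Finite := hω
  have hcard (n : ℕ) : U.whiteCount n ω ≤ hfin.toFinset.card := by
    refine Finset.card_le_card fun i hi => ?_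
    simp only [Finset.mem_filter, Finset.mem_Icc] at hi
    simpa using ⟨hi.1.1, hi.2⟩
  refine Set.mem_iUnion.2 ⟨N + hfin.toFinset.card, ?_⟩
  have := hcard (N + hfin.toFinset.card)
  simp only [Set.mem_ofPred_eq]
  omega

lemma monotone_redCount (U : RUM μ k f) (N : ℕ) :
    Monotone fun n => {ω | N ≤ n - U.whiteCount n ω} := by
  refine monotone_nat_of_le_succ fun n ω hω => ?_
  have h := U.whiteCount_succ n ω
  have hω : N ≤ n - U.whiteCount n ω := hω
  simp only [Set.mem_ofPred_eq]
  split_ifs at h <;> omega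

lemma measurable_whiteCount (U : RUM μ k f) (n : ℕ) : Measurable (U.whiteCount n) :=
  measurable_card_filter_true _ fun i _ => U.meas_X i

lemma measurable_comap_whiteCount (U : RUM μ k f) (n : ℕ) :
    Measurable[MeasurableSpace.comap (fun ω => fun i : Fin n => U.X (i + 1) ω) inferInstance]
      (U.whiteCount n) := by
  refine @measurable_card_filter_true Ω
    (MeasurableSpace.comap (fun ω => fun i : Fin n => U.X (i + 1) ω) inferInstance) _ _
    fun i hi => ?_
  obtain ⟨h1, h2⟩ := Finset.mem_Icc.1 hi
  have : U.X i = (fun x : Fin n → Bool => x ⟨i - 1, by omega⟩) ∘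
      (fun ω => fun i : Fin n => U.X (i + 1) ω) := by
    funext ω
    simp [Nat.sub_add_cancel h1]
  rw [this]
  exact (measurable_pi_apply _).comp (comap_measurable _)

lemma norm_comp_whiteCount_le (U : RUM μ k f) (n : ℕ) (G : ℕ → ℝ) (ω : Ω) :
    ‖G (U.whiteCount n ω)‖ ≤ ∑ a ∈ Finset.range (n + 1), ‖G a‖ :=
  Finset.single_le_sum (f := fun a => ‖G a‖) (fun _ _ => norm_nonneg _)
    (Finset.mem_range.2 (Nat.lt_succ_of_le (U.whiteCount_le n ω)))

lemma integrable_comp_whiteCount [IsProbabilityMeasure μ] (U : RUM μ k f) (n : ℕ) (G : ℕ → ℝ) :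
    Integrable (fun ω => G (U.whiteCount n ω)) μ :=
  Integrable.of_bound
    (Measurable.of_discrete.comp (U.measurable_whiteCount n)).aestronglyMeasurable _
    (ae_of_all _ (U.norm_comp_whiteCount_le n G))

lemma measurableSet_white (U : RUM μ k f) (n : ℕ) : MeasurableSet {ω | U.X n ω = true} :=
  U.meas_X n (measurableSet_singleton true)

lemma integrable_indicator_white [IsProbabilityMeasure μ] (U : RUM μ k f) (n : ℕ) :
    Integrable ({ω | U.X n ω = true}.indicator fun _ => (1 : ℝ)) μ :=
  (integrable_const 1).indicator (U.measurableSet_white n)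

/-- The conditional law of the next extraction, tested against functions of the number of
white balls picked so far. -/
lemma integral_comp_whiteCount_mul_indicator [IsProbabilityMeasure μ] (U : RUM μ k f) (n : ℕ)
    (G : ℕ → ℝ) :
    ∫ ω, G (U.whiteCount n ω) * {ω | U.X (n + 1) ω = true}.indicator (fun _ => (1 : ℝ)) ω ∂μ =
      ∫ ω, G (U.whiteCount n ω) * (f (k + U.whiteCount n ω) /
        (f (k + U.whiteCount n ω) + f (n + 1 - U.whiteCount n ω))) ∂μ := by
  have hm : MeasurableSpace.comap (fun ω => fun i : Fin n => U.X (i + 1) ω) inferInstance ≤ m0 :=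
    (measurable_pi_lambda _ fun i : Fin n => U.meas_X (i + 1)).comap_le
  have hG : StronglyMeasurable[MeasurableSpace.comap
      (fun ω => fun i : Fin n => U.X (i + 1) ω) inferInstance]
      (fun ω => G (U.whiteCount n ω)) :=
    (Measurable.of_discrete.comp (U.measurable_comap_whiteCount n)).stronglyMeasurable
  have h := condExp_stronglyMeasurable_mul_of_bound hm hG (U.integrable_indicator_white (n + 1))
    _ (ae_of_all μ (U.norm_comp_whiteCount_le n G))
  have h2 := integral_condExp (μ := μ) (f := (fun ω => G (U.whiteCount n ω)) *
    {ω | U.X (n + 1) ω = true}.indicator (fun _ => (1 : ℝ))) hm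
  refine h2.symm.trans (integral_congr_ae ?_)
  filter_upwards [h, U.cond_white n] with ω h3 h4
  rw [h3, Pi.mul_apply, h4]
  rfl

end RUM

/-- The factor contributed by `a` white extractions to the exponential martingale. -/
def whiteFactor (m a : ℕ) : ℝ :=
  ∏ j ∈ Finset.range a, (1 - (m : ℝ) ^ 2 / ((m : ℝ) + 1 + j) ^ 2)

/-- The factor contributed by `b` red extractions to the exponential martingale. -/
def redFactor (m b : ℕ) : ℝ :=
  ∏ j ∈ Finset.range b, (1 + (m : ℝ) ^ 2 / ((j : ℝ) + 1) ^ 2)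

lemma whiteFactor_mul_factorial (m a : ℕ) :
    whiteFactor m a * ((2 * m).factorial * ((m + a).factorial : ℝ) ^ 2) =
      (2 * m + a).factorial * a.factorial * (m.factorial : ℝ) ^ 2 := by
  induction a with
  | zero => simp [whiteFactor]
  | succ a ih =>
    have hs : whiteFactor m (a + 1) =
        whiteFactor m a * (1 - (m : ℝ) ^ 2 / ((m : ℝ) + 1 + a) ^ 2) :=
      Finset.prod_range_succ _ _
    have hne : (m : ℝ) + 1 + a ≠ 0 := by positivity
    have e : (1 - (m : ℝ) ^ 2 / ((m : ℝ) + 1 + a) ^ 2) * ((m : ℝ) + 1 + a) ^ 2 =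
        (a + 1) * (2 * m + a + 1) := by
      field_simp
      ring
    rw [hs, ← add_assoc, ← add_assoc, Nat.factorial_succ, Nat.factorial_succ, Nat.factorial_succ]
    push_cast
    calc _ = (whiteFactor m a * ((2 * m).factorial * ((m + a).factorial : ℝ) ^ 2)) *
          ((1 - (m : ℝ) ^ 2 / ((m : ℝ) + 1 + a) ^ 2) * ((m : ℝ) + 1 + a) ^ 2) := by ring
      _ = _ := by rw [ih, e]; ring

lemma sq_factorial_le (m a : ℕ) :
    (m + a).factorial ^ 2 ≤ (2 * m + a).factorial * a.factorial := by
  have h := Nat.choose_le_centralBinom a (m + a)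
  rw [Nat.centralBinom_eq_two_mul_choose] at h
  have h1 := Nat.choose_mul_factorial_mul_factorial (n := 2 * (m + a)) (k := a) (by omega)
  have h2 := Nat.choose_mul_factorial_mul_factorial (n := 2 * (m + a)) (k := m + a) (by omega)
  rw [show 2 * (m + a) - a = 2 * m + a by omega] at h1
  rw [show 2 * (m + a) - (m + a) = m + a by omega] at h2
  have hpos : 0 < (2 * (m + a)).choose (m + a) := Nat.choose_pos (by omega)
  refine Nat.le_of_mul_le_mul_left ?_ hpos
  calc (2 * (m + a)).choose (m + a) * (m + a).factorial ^ 2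
      = (2 * (m + a)).choose a * ((2 * m + a).factorial * a.factorial) := by
        linear_combination h2 - h1
    _ ≤ _ := Nat.mul_le_mul_right _ h

lemma inv_centralBinom_le_whiteFactor (m a : ℕ) :
    (m.centralBinom : ℝ)⁻¹ ≤ whiteFactor m a := by
  have hc : (m.centralBinom : ℝ) * (m.factorial : ℝ) ^ 2 = (2 * m).factorial := by
    have := Nat.choose_mul_factorial_mul_factorial (n := 2 * m) (k := m) (by omega)
    rw [show 2 * m - m = m by omega, ← Nat.centralBinom_eq_two_mul_choose] at this
    rw [← this]
    push_cast
    ring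
  have hB : (0 : ℝ) < m.centralBinom := by exact_mod_cast m.centralBinom_pos
  have hm : (0 : ℝ) < m.factorial := by exact_mod_cast m.factorial_pos
  have hma : (0 : ℝ) < (m + a).factorial := by exact_mod_cast (m + a).factorial_pos
  have hsq : ((m + a).factorial : ℝ) ^ 2 ≤ (2 * m + a).factorial * a.factorial := by
    exact_mod_cast sq_factorial_le m a
  have h := whiteFactor_mul_factorial m a
  rw [← hc] at h
  rw [inv_le_iff_one_le_mul₀' hB]
  refine le_of_mul_le_mul_right (a := (m.factorial : ℝ) ^ 2 * ((m + a).factorial : ℝ) ^ 2) ?_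
    (by positivity)
  calc _ = ((m + a).factorial : ℝ) ^ 2 * (m.factorial : ℝ) ^ 2 := by ring
    _ ≤ ((2 * m + a).factorial * a.factorial) * (m.factorial : ℝ) ^ 2 := by gcongr
    _ = _ := by rw [← h]; ring

lemma redFactor_mono (m : ℕ) : Monotone (redFactor m) := by
  refine monotone_nat_of_le_succ fun b => ?_
  rw [redFactor, redFactor, Finset.prod_range_succ]
  refine le_mul_of_one_le_right (Finset.prod_nonneg fun j _ => by positivity) ?_
  exact le_add_of_nonneg_right (by positivity)

lemma one_le_redFactor (m b : ℕ) : 1 ≤ redFactor m b := by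
  simpa [redFactor] using redFactor_mono m (Nat.zero_le b)

lemma tendsto_redFactor (m : ℕ) (hm : m ≠ 0) :
    Tendsto (redFactor m) atTop (nhds (Real.sinh (Real.pi * m) / (Real.pi * m))) := by
  have h := Complex.tendsto_euler_sin_prod (m * Complex.I)
  rw [← mul_assoc, Complex.sin_mul_I] at h
  have hne : Real.pi * m ≠ 0 := by positivity
  have h2 : Tendsto (fun n => Real.pi * m * redFactor m n) atTop
      (nhds (Real.sinh (Real.pi * m))) := by
    have h3 := (Complex.continuous_im.tendsto _).comp h
    convert h3 using 1
    · funext n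
      have : ∏ j ∈ Finset.range n, ((1 : ℂ) - (m * Complex.I) ^ 2 / ((j : ℂ) + 1) ^ 2) =
          (redFactor m n : ℂ) := by
        rw [redFactor, Complex.ofReal_prod]
        refine Finset.prod_congr rfl fun j _ => ?_
        push_cast
        rw [mul_pow, Complex.I_sq]
        ring
      simp only [Function.comp_apply]
      rw [this]
      rw [show (Real.pi : ℂ) * m * Complex.I * (redFactor m n : ℂ) =
        ((Real.pi * m * redFactor m n : ℝ) : ℂ) * Complex.I by push_cast; ring]
      simp
    · rw [show Complex.sinh (Real.pi * m) = ((Real.sinh (Real.pi * m) : ℝ) : ℂ) by push_cast; rfl]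
      rw [Complex.im_ofReal_mul, Complex.I_im, mul_one]
  have h4 := h2.div_const (Real.pi * m)
  refine h4.congr fun n => ?_
  field_simp

namespace RUM

variable {Ω : Type} [MeasurableSpace Ω] {μ : Measure Ω} [IsProbabilityMeasure μ] {m : ℕ}

lemma integral_whiteFactor_mul_redFactor (U : RUM μ (m + 1) fun j => (j : ℝ) ^ 2) (n : ℕ) :
    ∫ ω, whiteFactor m (U.whiteCount n ω) * redFactor m (n - U.whiteCount n ω) ∂μ = 1 := by
  induction n with
  | zero => simp [whiteCount_zero, whiteFactor, redFactor]
  | succ n ih =>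
    set M : ℕ → ℝ := fun a => whiteFactor m a * redFactor m (n - a)
    set p : ℕ → ℝ := fun a => (m : ℝ) ^ 2 / ((n - a : ℕ) + 1 : ℝ) ^ 2
    set q : ℕ → ℝ := fun a => (m : ℝ) ^ 2 / ((m : ℝ) + 1 + a) ^ 2
    set I : Ω → ℝ := {ω | U.X (n + 1) ω = true}.indicator fun _ => (1 : ℝ)
    have hstep (ω : Ω) : whiteFactor m (U.whiteCount (n + 1) ω) *
        redFactor m (n + 1 - U.whiteCount (n + 1) ω) =
        M (U.whiteCount n ω) + (M * p) (U.whiteCount n ω) -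
          (M * (p + q)) (U.whiteCount n ω) * I ω := by
      have hle := U.whiteCount_le n ω
      rw [whiteCount_succ]
      by_cases hX : U.X (n + 1) ω = true
      · have hI : I ω = 1 := Set.indicator_of_mem (by exact hX) _
        have hw : whiteFactor m (U.whiteCount n ω + 1) =
            whiteFactor m (U.whiteCount n ω) * (1 - q (U.whiteCount n ω)) :=
          Finset.prod_range_succ _ _
        rw [if_pos hX, hI, hw, Nat.add_sub_add_right]
        simp only [Pi.mul_apply, Pi.add_apply, M]
        ring
      · have hI : I ω = 0 := Set.indicator_of_notMem (by exact hX) _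
        have hr : redFactor m (n - U.whiteCount n ω + 1) =
            redFactor m (n - U.whiteCount n ω) * (1 + p (U.whiteCount n ω)) :=
          Finset.prod_range_succ _ _
        rw [if_neg hX, hI, add_zero, Nat.sub_add_comm hle, hr]
        simp only [Pi.mul_apply, Pi.add_apply, M]
        ring
    have hint : Integrable (fun ω => (M * (p + q)) (U.whiteCount n ω) * I ω) μ :=
      (U.integrable_indicator_white (n + 1)).bdd_mul
        (Measurable.of_discrete.comp (U.measurable_whiteCount n)).aestronglyMeasurable
        (ae_of_all _ (U.norm_comp_whiteCount_le n _))
    have hM := U.integrable_comp_whiteCount n M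
    have hMp := U.integrable_comp_whiteCount n (M * p)
    simp_rw [hstep]
    rw [integral_sub (f := fun ω => M (U.whiteCount n ω) + (M * p) (U.whiteCount n ω))
        (hM.add hMp) hint, integral_add hM hMp, ih,
      U.integral_comp_whiteCount_mul_indicator n, add_sub_assoc, add_eq_left, sub_eq_zero]
    refine integral_congr_ae (ae_of_all _ fun ω => ?_)
    have hle := U.whiteCount_le n ω
    simp only [Pi.mul_apply, Pi.add_apply, p, q]
    rw [Nat.sub_add_comm hle]
    push_cast
    set a : ℝ := (U.whiteCount n ω : ℝ)
    set b : ℝ := ((n - U.whiteCount n ω : ℕ) : ℝ)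
    have ha : (m : ℝ) + 1 + a ≠ 0 := by positivity
    have hb : b + 1 ≠ 0 := by positivity
    have hab : ((m : ℝ) + 1 + a) ^ 2 + (b + 1) ^ 2 ≠ 0 := by positivity
    field_simp

lemma measureReal_redCount_ge_mul_le (U : RUM μ (m + 1) fun j => (j : ℝ) ^ 2) (n N : ℕ) :
    μ.real {ω | N ≤ n - U.whiteCount n ω} * (redFactor m N - 1) ≤ m.centralBinom - 1 := by
  have hB : (0 : ℝ) < m.centralBinom := by exact_mod_cast m.centralBinom_pos
  have hS : MeasurableSet {ω | N ≤ n - U.whiteCount n ω} :=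
    measurableSet_le measurable_const
      ((Measurable.of_discrete (f := fun a : ℕ => n - a)).comp (U.measurable_whiteCount n))
  set S := {ω | N ≤ n - U.whiteCount n ω}
  have hSint : Integrable (S.indicator fun _ => redFactor m N - 1) μ :=
    (integrable_const _).indicator hS
  have hle : ∫ ω, (m.centralBinom : ℝ)⁻¹ * (1 + S.indicator (fun _ => redFactor m N - 1) ω) ∂μ ≤
      ∫ ω, whiteFactor m (U.whiteCount n ω) * redFactor m (n - U.whiteCount n ω) ∂μ := by
    refine integral_mono (((integrable_const 1).add hSint).const_mul _)
      (U.integrable_comp_whiteCount n fun a => whiteFactor m a * redFactor m (n - a))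
      fun ω => ?_
    have hw := inv_centralBinom_le_whiteFactor m (U.whiteCount n ω)
    refine mul_le_mul hw ?_ ?_ ((inv_nonneg.2 hB.le).trans hw)
    · by_cases h : ω ∈ S
      · rw [Set.indicator_of_mem h]
        linarith [redFactor_mono m (show N ≤ n - U.whiteCount n ω from h)]
      · rw [Set.indicator_of_notMem h, add_zero]
        exact one_le_redFactor _ _
    · have : 0 ≤ S.indicator (fun _ => redFactor m N - 1) ω :=
        Set.indicator_nonneg (fun _ _ => sub_nonneg.2 (one_le_redFactor m N)) ω
      linarith
  rw [U.integral_whiteFactor_mul_redFactor, integral_const_mul,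
    integral_add (integrable_const 1) hSint, integral_indicator hS, setIntegral_const,
    inv_mul_le_iff₀ hB] at hle
  simp only [integral_const, probReal_univ, smul_eq_mul] at hle
  linarith

lemma measureReal_finite_whites_mul_le (U : RUM μ (m + 1) fun j => (j : ℝ) ^ 2) (hm : m ≠ 0) :
    μ.real {ω | {n | 1 ≤ n ∧ U.X n ω = true}.Finite} *
      (Real.sinh (Real.pi * m) / (Real.pi * m) - 1) ≤ m.centralBinom - 1 := by
  refine le_of_tendsto' (((tendsto_redFactor m hm).sub_const 1).const_mul _) fun N => ?_
  have h1 : Tendsto (fun n => μ.real {ω | N ≤ n - U.whiteCount n ω}) atTop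
      (nhds (μ.real (⋃ n, {ω | N ≤ n - U.whiteCount n ω}))) :=
    (ENNReal.tendsto_toReal (measure_ne_top _ _)).comp
      (tendsto_measure_iUnion_atTop (U.monotone_redCount N))
  have h2 := le_of_tendsto' (h1.mul_const (redFactor m N - 1))
    fun n => U.measureReal_redCount_ge_mul_le n N
  refine le_trans ?_ h2
  exact mul_le_mul_of_nonneg_right (measureReal_mono (U.finite_whites_subset N))
    (sub_nonneg.2 (one_le_redFactor m N))

end RUM

lemma exp_pi_gt : 23 < Real.exp Real.pi := by
  have h1 := Real.pi_gt_d4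
  have h2 : Real.exp 3 * (1 + 0.1415 + 0.1415 ^ 2 / 2) ≤ Real.exp Real.pi := by
    rw [show Real.pi = 3 + (Real.pi - 3) by ring, Real.exp_add]
    have h5 := Real.quadratic_le_exp_of_nonneg (x := Real.pi - 3) (by linarith)
    gcongr
    nlinarith
  have h3 : Real.exp 3 = Real.exp 1 ^ 3 := by rw [← Real.exp_nat_mul]; norm_num
  have h4 : (2.7182818283 : ℝ) ^ 3 ≤ Real.exp 1 ^ 3 := by
    gcongr
    exact Real.exp_one_gt_d9.le
  rw [← h3] at h4
  norm_num at h2 h4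
  linarith

lemma sinh_pi_mul_ge {m : ℕ} (hm : m ≠ 0) :
    ((23 : ℝ) ^ m - 1 / 20) / 2 ≤ Real.sinh (Real.pi * m) := by
  have h1 : (23 : ℝ) ^ m ≤ Real.exp (Real.pi * m) := by
    rw [mul_comm, Real.exp_nat_mul]
    exact pow_le_pow_left₀ (by norm_num) exp_pi_gt.le m
  have h2 : Real.exp (-(Real.pi * m)) ≤ 1 / 20 := by
    rw [Real.exp_neg, one_div]
    exact inv_anti₀ (by norm_num)
      (((by norm_num : (20 : ℝ) ≤ 23).trans (le_self_pow₀ (by norm_num) hm)).trans h1)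
  rw [Real.sinh_eq]
  linarith

lemma exp_pi_mul_sinh_le {x : ℝ} : Real.exp Real.pi * Real.sinh x ≤ Real.sinh (x + Real.pi) := by
  have h : Real.exp (-(x + Real.pi)) ≤ Real.exp (Real.pi - x) :=
    Real.exp_le_exp.2 (by linarith [Real.pi_pos])
  have h1 : Real.exp Real.pi * Real.exp x = Real.exp (x + Real.pi) := by
    rw [← Real.exp_add, add_comm]
  have h2 : Real.exp Real.pi * Real.exp (-x) = Real.exp (Real.pi - x) := by
    rw [← Real.exp_add, sub_eq_add_neg]
  rw [Real.sinh_eq, Real.sinh_eq]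
  linarith

lemma centralBinom_mul_exp_le_sinh {m : ℕ} (hm : 4 ≤ m) :
    2 * m.centralBinom * Real.exp m * (Real.pi * m) ≤ Real.sinh (Real.pi * m) := by
  have he := Real.exp_one_lt_d9
  induction m, hm using Nat.le_induction with
  | base =>
    have h1 := sinh_pi_mul_ge (m := 4) (by norm_num)
    have h2 : Real.exp (4 : ℕ) ≤ 55 := by
      rw [← mul_one ((4 : ℕ) : ℝ), Real.exp_nat_mul]
      calc Real.exp 1 ^ 4 ≤ 2.7182818286 ^ 4 := by gcongr
        _ ≤ 55 := by norm_num
    have hc : Nat.centralBinom 4 = 70 := by decide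
    have h3 : Real.exp (4 : ℕ) * Real.pi ≤ 55 * 3.1416 :=
      mul_le_mul h2 Real.pi_lt_d4.le Real.pi_pos.le (by norm_num)
    rw [hc]
    norm_num at h1 h3 ⊢
    linarith
  | succ m hm ih =>
    have hB : (m.succ.centralBinom : ℝ) * (m + 1) ≤ 4 * m.centralBinom * (m + 1) := by
      have := Nat.succ_mul_centralBinom_succ m
      have : (m + 1) * (m + 1).centralBinom ≤ 4 * m.centralBinom * (m + 1) := by
        rw [this]
        nlinarith
      rw [mul_comm]
      exact_mod_cast this
    have hm' : (4 : ℝ) ≤ m := by exact_mod_cast hm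
    have hs : Real.exp Real.pi * Real.sinh (Real.pi * m) ≤ Real.sinh (Real.pi * (m + 1 : ℕ)) := by
      convert exp_pi_mul_sinh_le using 2
      push_cast
      ring
    refine le_trans ?_ hs
    have hX : 0 ≤ 2 * m.centralBinom * Real.exp m * Real.pi := by
      have := Real.pi_pos
      positivity
    have hexp : Real.exp (m + 1 : ℕ) = Real.exp m * Real.exp 1 := by
      push_cast
      exact Real.exp_add _ _
    calc 2 * ((m + 1).centralBinom : ℝ) * Real.exp (m + 1 : ℕ) * (Real.pi * (m + 1 : ℕ))
        = ((m.succ.centralBinom : ℝ) * (m + 1)) * (2 * Real.exp m * Real.exp 1 * Real.pi) := by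
          rw [hexp]
          push_cast
          ring
      _ ≤ (4 * m.centralBinom * (m + 1)) * (2 * Real.exp m * Real.exp 1 * Real.pi) := by
          have := Real.pi_pos
          gcongr
      _ = (2 * m.centralBinom * Real.exp m * Real.pi) * (4 * (m + 1) * Real.exp 1) := by ring
      _ ≤ (2 * m.centralBinom * Real.exp m * Real.pi) * (23 * m) := by
          refine mul_le_mul_of_nonneg_left ?_ hX
          nlinarith
      _ = 23 * (2 * m.centralBinom * Real.exp m * (Real.pi * m)) := by ring
      _ ≤ Real.exp Real.pi * Real.sinh (Real.pi * m) :=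
          mul_le_mul exp_pi_gt.le ih (by positivity) (Real.exp_pos _).le

lemma div_pi_mul_le_sinh_div (m : ℕ) (hm : m ≠ 0) :
    ((23 : ℝ) ^ m - 1 / 20) / 2 / (3.1416 * m) ≤ Real.sinh (Real.pi * m) / (Real.pi * m) := by
  have h0 : (1 : ℝ) ≤ 23 ^ m := one_le_pow₀ (by norm_num)
  have hm' : (0 : ℝ) < m := by positivity
  have h1 := sinh_pi_mul_ge hm
  exact div_le_div₀ ((div_nonneg (by linarith) (by norm_num)).trans h1) h1
    (by positivity) (mul_le_mul_of_nonneg_right Real.pi_lt_d4.le hm'.le)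

lemma pi_div_two_sqrt_ge {x y : ℝ} (hx : 0 < x) (hy : 0 ≤ y) (h : x ≤ y ^ 2) :
    3.1415 / (2 * y) ≤ Real.pi / (2 * Real.sqrt x) :=
  div_le_div₀ Real.pi_pos.le Real.pi_gt_d4.le (by positivity)
    (by linarith [Real.sqrt_le_iff.2 ⟨hy, h⟩])

lemma exp_neg_one_gt : 0.367 < Real.exp (-1) := by
  rw [Real.exp_neg, lt_inv_comm₀ (by norm_num) (Real.exp_pos _)]
  exact Real.exp_one_lt_d9.trans (by norm_num)

lemma centralBinom_sub_one_le (m : ℕ) (hm : m ≠ 0) :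
    (m.centralBinom : ℝ) - 1 ≤ (1 / 2 * Real.exp (-m + Real.pi / (2 * Real.sqrt (m + 3)))) *
      (Real.sinh (Real.pi * m) / (Real.pi * m) - 1) := by
  have hs := div_pi_mul_le_sinh_div m hm
  have he := exp_neg_one_gt
  have hpi := Real.pi_pos
  rcases lt_or_ge m 4 with h4 | h4
  · have key (b c : ℝ) (hc : 0 ≤ c) (h1 : c ≤ Real.exp (-m + Real.pi / (2 * Real.sqrt (m + 3))))
        (h2 : 1 ≤ ((23 : ℝ) ^ m - 1 / 20) / 2 / (3.1416 * m))
        (h3 : b ≤ 1 / 2 * c * (((23 : ℝ) ^ m - 1 / 20) / 2 / (3.1416 * m) - 1)) :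
        b ≤ (1 / 2 * Real.exp (-m + Real.pi / (2 * Real.sqrt (m + 3)))) *
          (Real.sinh (Real.pi * m) / (Real.pi * m) - 1) := by
      refine h3.trans (mul_le_mul (by linarith) (by linarith) (by linarith) (by positivity))
    interval_cases m
    · exact absurd rfl hm
    · have hr := pi_div_two_sqrt_ge (x := (1 : ℕ) + 3) (y := 2) (by norm_num) (by norm_num)
        (by norm_num)
      have hc : Nat.centralBinom 1 = 2 := by decide
      refine key _ 0.785 (by norm_num) ?_ (by norm_num) (by rw [hc]; norm_num)
      refine le_trans ?_ (Real.add_one_le_exp _)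
      norm_num at hr ⊢
      linarith
    · have hr := pi_div_two_sqrt_ge (x := (2 : ℕ) + 3) (y := 2.2361) (by norm_num) (by norm_num)
        (by norm_num)
      have hc : Nat.centralBinom 2 = 6 := by decide
      refine key _ (0.367 * 0.702) (by norm_num) ?_ (by norm_num) (by rw [hc]; norm_num)
      have h := Real.add_one_le_exp (-1 + Real.pi / (2 * Real.sqrt ((2 : ℕ) + 3)))
      rw [show -((2 : ℕ) : ℝ) + Real.pi / (2 * Real.sqrt ((2 : ℕ) + 3)) =
        -1 + (-1 + Real.pi / (2 * Real.sqrt ((2 : ℕ) + 3))) by push_cast; ring, Real.exp_add]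
      refine mul_le_mul he.le ?_ (by norm_num) (Real.exp_pos _).le
      norm_num at hr h ⊢
      linarith
    · have hc : Nat.centralBinom 3 = 20 := by decide
      refine key _ (0.367 ^ 3 * 1.63) (by norm_num) ?_ (by norm_num) (by rw [hc]; norm_num)
      have hr := pi_div_two_sqrt_ge (x := (3 : ℕ) + 3) (y := 2.45) (by norm_num) (by norm_num)
        (by norm_num)
      have h := Real.add_one_le_exp (Real.pi / (2 * Real.sqrt ((3 : ℕ) + 3)))
      have h3 : Real.exp (-((3 : ℕ) : ℝ)) = Real.exp (-1) ^ 3 := by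
        rw [← Real.exp_nat_mul]
        norm_num
      rw [Real.exp_add, h3]
      refine mul_le_mul (pow_le_pow_left₀ (by norm_num) he.le 3) ?_ (by norm_num) (by positivity)
      norm_num at hr h ⊢
      linarith
  · have h1 := centralBinom_mul_exp_le_sinh h4
    have hm' : (0 : ℝ) < m := by positivity
    rw [← le_div_iff₀ (by positivity)] at h1
    have hB : (1 : ℝ) ≤ m.centralBinom := by exact_mod_cast m.centralBinom_pos
    have h2 : Real.exp (-m) ≤ Real.exp (-m + Real.pi / (2 * Real.sqrt (m + 3))) :=
      Real.exp_le_exp.2 (le_add_of_nonneg_right (by positivity))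
    have h3 : Real.exp (-(m : ℝ)) ≤ 1 := Real.exp_le_one_iff.2 (by linarith)
    have h5 : Real.exp (-(m : ℝ)) * Real.exp m = 1 := by rw [← Real.exp_add]; simp
    have h6 : 1 ≤ Real.exp (m : ℝ) := Real.one_le_exp hm'.le
    calc (m.centralBinom : ℝ) - 1 ≤ m.centralBinom - 1 / 2 * Real.exp (-m) := by linarith
      _ = 1 / 2 * Real.exp (-m) * (2 * m.centralBinom * Real.exp m - 1) := by
          linear_combination (-(m.centralBinom : ℝ)) * h5
      _ ≤ _ := by
          refine mul_le_mul (by linarith) (by linarith) ?_ (by positivity)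
          nlinarith

lemma one_le_half_exp_pi_div : 1 ≤ 1 / 2 * Real.exp (Real.pi / (2 * Real.sqrt 3)) := by
  have hr := pi_div_two_sqrt_ge (x := 3) (y := 1.7321) (by norm_num) (by norm_num) (by norm_num)
  have h := Real.quadratic_le_exp_of_nonneg (x := Real.pi / (2 * Real.sqrt 3)) (by
    have := Real.pi_pos
    positivity)
  norm_num at hr
  nlinarith


/-- Consequence of Theorem 1.6 for `f(j) = j²`: for a `RUM(k, j ↦ j²)`, the probability
that only finitely many white balls are ever picked is at most
`(1/2) exp(−(k−1) + π/(2√(k+2)))`. -/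
theorem rum_square_finitely_many_whites_bound
    {Ω : Type} [MeasurableSpace Ω] (μ : Measure Ω) [IsProbabilityMeasure μ]
    (k : ℕ) (hk : 1 ≤ k)
    (U : RUM μ k (fun j => (j : ℝ) ^ 2)) :
    μ {ω | {n | 1 ≤ n ∧ U.X n ω = true}.Finite} ≤
      ENNReal.ofReal
        ((1 / 2) * Real.exp (-((k : ℝ) - 1) + Real.pi / (2 * Real.sqrt ((k : ℝ) + 2)))) := by
  obtain ⟨m, rfl⟩ := Nat.exists_eq_add_of_le' hk
  have hexp : -(((m + 1 : ℕ) : ℝ) - 1) + Real.pi / (2 * Real.sqrt (((m + 1 : ℕ) : ℝ) + 2)) =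
      -m + Real.pi / (2 * Real.sqrt (m + 3)) := by
    push_cast
    ring_nf
  rw [hexp]
  refine (ENNReal.le_ofReal_iff_toReal_le (measure_ne_top _ _) (by positivity)).2 ?_
  change μ.real _ ≤ _
  rcases eq_or_ne m 0 with rfl | hm
  · refine measureReal_le_one.trans ?_
    simpa using one_le_half_exp_pi_div
  · have hpos : 0 < Real.sinh (Real.pi * m) / (Real.pi * m) - 1 := by
      have : 0 < Real.pi * m := by
        have := Real.pi_pos
        positivity
      rw [sub_pos, one_lt_div this]
      exact Real.self_lt_sinh_iff.2 this
    exact le_of_mul_le_mul_right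
      ((U.measureReal_finite_whites_mul_le hm).trans (centralBinom_sub_one_le m hm)) hpos
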